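/- arXiv:1212.5108 — 2 statements merged into one kernel-verified Lean document; each statement's English description precedes it below -/
import Mathlib

section
/- The class of languages of bidimensional context-free hedge automata is not closed under complementation: there exist a finite alphabet Σ and a CF²HA A over Σ such that no CF²HA over Σ recognizes the hedge language H(Σ) \ L(A). -/
/-- Unranked trees over alphabet `α`, with variables indexed by `ℕ` at leaves. -/
inductive VTree (α : Type) : Type where
  | var : ℕ → VTree α
  | node : α → List (VTree α) → VTree α

/-- A hedge is a finite sequence of trees. -/
abbrev VHedge (α : Type) := List (VTree α)

/-- Relabeling of trees. -/
def VTree.map {α β : Type} (f : α → β) : VTree α → VTree β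
  | .var x => .var x
  | .node a ts => .node (f a) (ts.attach.map fun t => t.1.map f)
decreasing_by
  have := List.sizeOf_lt_of_mem t.2
  simp only [VTree.node.sizeOf_spec]
  omega

/-- Relabeling of hedges. -/
def hedgeMap {α β : Type} (f : α → β) (h : VHedge α) : VHedge β := h.map (VTree.map f)

/-- A tree is ground if it contains no variable. -/
inductive GroundT {α : Type} : VTree α → Prop where
  | node {a : α} {ts : List (VTree α)} : (∀ t ∈ ts, GroundT t) → GroundT (.node a ts)

/-- A hedge is ground (an element of `H(Σ)`) if all its trees are ground. -/
def Ground {α : Type} (h : VHedge α) : Prop := ∀ t ∈ h, GroundT t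

/-- A bidimensional context-free hedge automaton (CF²HA) over alphabet `S` with
states `Q`. A horizontal transition `p₁(δ₁)…pₙ(δₙ) → q(δ₁…δₙ)` is encoded as a
list of pairs `(pᵢ, bᵢ)` with `pᵢ ∈ S ⊕ Q` and `bᵢ : Bool` telling whether
`δᵢ` is a variable (`true`) or forced to be the empty hedge `ε` (`false`),
together with the target state `q`. A vertical transition `p₁(p₂(δ)) → q(δ)` is
encoded as `(p₁, p₂, b, q)`. Transition sets are finite. -/
structure CF2HA (S Q : Type) where
  final : Set Q
  hor : Set (List ((S ⊕ Q) × Bool) × Q)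
  ver : Set ((S ⊕ Q) × (S ⊕ Q) × Bool × Q)
  hor_fin : hor.Finite
  ver_fin : ver.Finite

/-- The move relation of a CF²HA: the rewrite relation on ground hedges over
`Σ ∪ Q` induced by its transitions (closed under contexts). -/
inductive CF2HA.Step {S Q : Type} (A : CF2HA S Q) :
    VHedge (S ⊕ Q) → VHedge (S ⊕ Q) → Prop where
  | hor {ps : List ((S ⊕ Q) × Bool)} {q : Q} (hs : List (VHedge (S ⊕ Q))) :
      (ps, q) ∈ A.hor → hs.length = ps.length →
      (∀ pb ∈ List.zip ps hs, pb.1.2 = false → pb.2 = []) →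
      CF2HA.Step A (List.zipWith (fun p h => VTree.node p.1 h) ps hs)
        [VTree.node (Sum.inr q) hs.flatten]
  | ver {p₁ p₂ : S ⊕ Q} {b : Bool} {q : Q} (h : VHedge (S ⊕ Q)) :
      (p₁, p₂, b, q) ∈ A.ver → (b = false → h = []) →
      CF2HA.Step A [VTree.node p₁ [VTree.node p₂ h]] [VTree.node (Sum.inr q) h]
  | ctx_hor {h h' : VHedge (S ⊕ Q)} (pre post : VHedge (S ⊕ Q)) :
      CF2HA.Step A h h' → CF2HA.Step A (pre ++ h ++ post) (pre ++ h' ++ post)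
  | ctx_ver {h h' : VHedge (S ⊕ Q)} (a : S ⊕ Q) :
      CF2HA.Step A h h' → CF2HA.Step A [VTree.node a h] [VTree.node a h']

/-- `L(A, q)`: ground hedges over `S` that reduce to `q(ε)`. -/
def CF2HA.stateLang {S Q : Type} (A : CF2HA S Q) (q : Q) : Set (VHedge S) :=
  { h | Ground h ∧
    Relation.ReflTransGen A.Step (hedgeMap Sum.inl h) [VTree.node (Sum.inr q) []] }

/-- `L(A)`: hedges accepted in some final state. -/
def CF2HA.lang {S Q : Type} (A : CF2HA S Q) : Set (VHedge S) :=
  { h | ∃ q ∈ A.final, h ∈ A.stateLang q }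

/-! ### Flat hedges and the grammar of a CF²HA -/

/-- The hedge of leaves spelling a word. -/
def flatHedge {α : Type} (w : List α) : VHedge α := w.map fun a => VTree.node a []

/-- `A.Derives w p`: the word `w`, read as a hedge of leaves, reduces to the leaf `p(ε)`.
This describes the restriction of `A` to flat hedges as a context-free grammar. -/
inductive CF2HA.Derives {S Q : Type} (A : CF2HA S Q) : List S → S ⊕ Q → Prop where
  | letter (a : S) : CF2HA.Derives A [a] (Sum.inl a)
  | hor {q : Q} (zs : List (List S × (S ⊕ Q) × Bool)) :
      (zs.map Prod.snd, q) ∈ A.hor → (∀ z ∈ zs, CF2HA.Derives A z.1 z.2.1) →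
      CF2HA.Derives A (zs.flatMap Prod.fst) (Sum.inr q)
  | ver {p₁ p₂ : S ⊕ Q} {b : Bool} {q : Q} {w : List S} :
      (p₁, p₂, b, q) ∈ A.ver → CF2HA.Derives A w p₁ → CF2HA.Derives A [] p₂ →
      CF2HA.Derives A w (Sum.inr q)

/-- The words whose flat hedge can reduce to a given hedge: the roots derive consecutive
factors of the word, and everything below the roots is derived from the empty word. -/
inductive CF2HA.Covers {S Q : Type} (A : CF2HA S Q) : List S → VHedge (S ⊕ Q) → Prop where
  | nil : CF2HA.Covers A [] []
  | cons {u v : List S} {p : S ⊕ Q} {h ts : VHedge (S ⊕ Q)} :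
      A.Derives u p → CF2HA.Covers A [] h → CF2HA.Covers A v ts →
      CF2HA.Covers A (u ++ v) (VTree.node p h :: ts)

namespace CF2HA

variable {S Q : Type} {A : CF2HA S Q}

theorem covers_cons_iff {w : List S} {p : S ⊕ Q} {h ts : VHedge (S ⊕ Q)} :
    A.Covers w (VTree.node p h :: ts) ↔
      ∃ u v, w = u ++ v ∧ A.Derives u p ∧ A.Covers [] h ∧ A.Covers v ts := by
  constructor
  · generalize hk : VTree.node p h :: ts = k
    intro hc
    cases hc with
    | nil => cases hk
    | cons hd hh ht =>
      cases hk
      exact ⟨_, _, rfl, hd, hh, ht⟩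
  · rintro ⟨u, v, rfl, hd, hh, ht⟩
    exact .cons hd hh ht

theorem covers_nil_iff {w : List S} : A.Covers w [] ↔ w = [] :=
  ⟨fun h => by cases h; rfl, fun h => h ▸ .nil⟩

theorem covers_singleton_iff {w : List S} {p : S ⊕ Q} {h : VHedge (S ⊕ Q)} :
    A.Covers w [VTree.node p h] ↔ A.Derives w p ∧ A.Covers [] h := by
  rw [covers_cons_iff]
  constructor
  · rintro ⟨u, v, rfl, hd, hh, ht⟩
    rw [covers_nil_iff.1 ht, List.append_nil]
    exact ⟨hd, hh⟩
  · rintro ⟨hd, hh⟩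
    exact ⟨w, [], by simp, hd, hh, .nil⟩

theorem Covers.append {u v : List S} {h k : VHedge (S ⊕ Q)} (hu : A.Covers u h)
    (hv : A.Covers v k) : A.Covers (u ++ v) (h ++ k) := by
  induction hu with
  | nil => exact hv
  | cons hd hh _ _ ih =>
    rw [List.append_assoc]
    exact .cons hd hh ih

theorem Covers.of_append {w : List S} {h k : VHedge (S ⊕ Q)} (hc : A.Covers w (h ++ k)) :
    ∃ u v, w = u ++ v ∧ A.Covers u h ∧ A.Covers v k := by
  induction h generalizing w with
  | nil => exact ⟨[], w, rfl, .nil, hc⟩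
  | cons t h ih =>
    rw [List.cons_append] at hc
    generalize hm : t :: (h ++ k) = m at hc
    cases hc with
    | nil => cases hm
    | cons hd hh ht =>
      cases hm
      obtain ⟨u, v, rfl, hu, hv⟩ := ih ht
      exact ⟨_, v, (List.append_assoc _ _ _).symm, .cons hd hh hu, hv⟩

theorem Covers.of_zipWith {ps : List ((S ⊕ Q) × Bool)} {hs : List (VHedge (S ⊕ Q))}
    {w : List S} (hl : hs.length = ps.length)
    (hc : A.Covers w (List.zipWith (fun p h => VTree.node p.1 h) ps hs)) :
    A.Covers [] hs.flatten ∧ ∃ zs : List (List S × (S ⊕ Q) × Bool),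
      zs.map Prod.snd = ps ∧ (∀ z ∈ zs, A.Derives z.1 z.2.1) ∧ w = zs.flatMap Prod.fst := by
  induction ps generalizing hs w with
  | nil =>
    obtain rfl : hs = [] := by simpa using hl
    exact ⟨.nil, [], rfl, by simp, by simpa using covers_nil_iff.1 hc⟩
  | cons p ps ih =>
    obtain _ | ⟨h, hs⟩ := hs
    · simp at hl
    rw [List.zipWith_cons_cons, covers_cons_iff] at hc
    obtain ⟨u, v, rfl, hd, hh, ht⟩ := hc
    obtain ⟨hf, zs, rfl, hz, rfl⟩ := ih (by simpa using hl) ht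
    refine ⟨hh.append hf, (u, p) :: zs, rfl, ?_, rfl⟩
    rintro z (_ | ⟨_, hm⟩)
    · exact hd
    · exact hz z hm

theorem Covers.step {h k : VHedge (S ⊕ Q)} (hs : A.Step h k) {w : List S}
    (hc : A.Covers w h) : A.Covers w k := by
  induction hs generalizing w with
  | hor hs hq hl _ =>
    obtain ⟨hf, zs, rfl, hz, rfl⟩ := hc.of_zipWith hl
    exact covers_singleton_iff.2 ⟨.hor zs hq hz, hf⟩
  | ver h hq _ =>
    obtain ⟨hd, hh⟩ := covers_singleton_iff.1 hc
    obtain ⟨hd', hh'⟩ := covers_singleton_iff.1 hh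
    exact covers_singleton_iff.2 ⟨.ver hq hd hd', hh'⟩
  | ctx_hor pre post _ ih =>
    obtain ⟨u, v, rfl, hu, hv⟩ := hc.of_append
    obtain ⟨u₁, u₂, rfl, hu₁, hu₂⟩ := hu.of_append
    exact (hu₁.append (ih hu₂)).append hv
  | ctx_ver a _ ih =>
    obtain ⟨hd, hh⟩ := covers_singleton_iff.1 hc
    exact covers_singleton_iff.2 ⟨hd, ih hh⟩

theorem covers_flatHedge (w : List S) : A.Covers w (flatHedge (w.map Sum.inl)) := by
  induction w with
  | nil => exact .nil
  | cons a w ih => exact .cons (.letter a) .nil ih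

theorem Covers.steps {h k : VHedge (S ⊕ Q)} (hs : Relation.ReflTransGen A.Step h k)
    {w : List S} (hc : A.Covers w h) : A.Covers w k := by
  induction hs with
  | refl => exact hc
  | tail _ hs ih => exact ih.step hs

theorem steps_append {h h' k k' : VHedge (S ⊕ Q)} (hh : Relation.ReflTransGen A.Step h h')
    (hk : Relation.ReflTransGen A.Step k k') :
    Relation.ReflTransGen A.Step (h ++ k) (h' ++ k') := by
  have h₁ : Relation.ReflTransGen A.Step (h ++ k) (h' ++ k) :=
    hh.lift (· ++ k) fun _ _ hs => by simpa using Step.ctx_hor [] k hs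
  have h₂ : Relation.ReflTransGen A.Step (h' ++ k) (h' ++ k') :=
    hk.lift (h' ++ ·) fun _ _ hs => by simpa using Step.ctx_hor h' [] hs
  exact h₁.trans h₂

theorem flatHedge_append {α : Type} (u v : List α) :
    flatHedge (u ++ v) = flatHedge u ++ flatHedge v := List.map_append

theorem steps_flatMap (zs : List (List S × (S ⊕ Q) × Bool))
    (hz : ∀ z ∈ zs, Relation.ReflTransGen A.Step (flatHedge (z.1.map Sum.inl))
      [VTree.node z.2.1 []]) :
    Relation.ReflTransGen A.Step (flatHedge ((zs.flatMap Prod.fst).map Sum.inl))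
      (List.zipWith (fun p h => VTree.node p.1 h) (zs.map Prod.snd)
        (List.replicate zs.length [])) := by
  induction zs with
  | nil => exact .refl
  | cons z zs ih =>
    rw [List.flatMap_cons, List.map_append, flatHedge_append]
    exact steps_append (hz z (by simp)) (ih fun y hy => hz y (by simp [hy]))

theorem Derives.steps {w : List S} {p : S ⊕ Q} (hd : A.Derives w p) :
    Relation.ReflTransGen A.Step (flatHedge (w.map Sum.inl)) [VTree.node p []] := by
  induction hd with
  | letter a => exact .refl
  | @hor q zs hq _ ih =>
    refine (steps_flatMap zs ih).tail ?_
    have := Step.hor (A := A) (List.replicate zs.length []) hq (by simp)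
      (fun pb hpb _ => List.eq_of_mem_replicate (List.of_mem_zip hpb).2)
    simpa using this
  | ver hq _ _ ih₁ ih₂ =>
    refine (ih₁.trans (ih₂.lift (fun h => [VTree.node _ h]) fun _ _ hs => .ctx_ver _ hs)).tail ?_
    exact .ver [] hq fun _ => rfl

theorem hedgeMap_flatHedge {α β : Type} (f : α → β) (w : List α) :
    hedgeMap f (flatHedge w) = flatHedge (w.map f) := by
  simp [hedgeMap, flatHedge, VTree.map]

theorem ground_flatHedge {α : Type} (w : List α) : Ground (flatHedge w) := by
  intro t ht
  obtain ⟨a, _, rfl⟩ := List.mem_map.1 ht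
  exact .node (by simp)

theorem flatHedge_mem_lang_iff {w : List S} :
    flatHedge w ∈ A.lang ↔ ∃ q ∈ A.final, A.Derives w (Sum.inr q) := by
  refine exists_congr fun q => and_congr_right fun _ => ⟨fun h => ?_, fun h => ?_⟩
  · have hs := h.2
    rw [hedgeMap_flatHedge] at hs
    exact (covers_singleton_iff.1 ((covers_flatHedge w).steps hs)).1
  · exact ⟨ground_flatHedge w, by rw [hedgeMap_flatHedge]; exact h.steps⟩

/-! ### Useful symbols and factors of controlled length -/

/-- A symbol is useful if some context turns every word it derives into an accepted word. -/
def Useful (A : CF2HA S Q) (p : S ⊕ Q) : Prop :=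
  ∃ x z : List S, ∀ y, A.Derives y p → flatHedge (x ++ y ++ z) ∈ A.lang

theorem useful_of_mem_final {q : Q} (hq : q ∈ A.final) : A.Useful (Sum.inr q) :=
  ⟨[], [], fun y hy => by simpa using flatHedge_mem_lang_iff.2 ⟨q, hq, hy⟩⟩

theorem Useful.of_hor {q : Q} {zs : List (List S × (S ⊕ Q) × Bool)}
    (hu : A.Useful (Sum.inr q)) (hq : (zs.map Prod.snd, q) ∈ A.hor)
    (hz : ∀ z ∈ zs, A.Derives z.1 z.2.1) {z : List S × (S ⊕ Q) × Bool} (hm : z ∈ zs) :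
    A.Useful z.2.1 := by
  obtain ⟨x, x', hx⟩ := hu
  obtain ⟨l, r, rfl⟩ := List.append_of_mem hm
  refine ⟨x ++ l.flatMap Prod.fst, r.flatMap Prod.fst ++ x', fun y hy => ?_⟩
  have hd : A.Derives ((l ++ (y, z.2) :: r).flatMap Prod.fst) (Sum.inr q) := by
    refine .hor _ (by simpa using hq) fun z' hz' => ?_
    rcases List.mem_append.1 hz' with h | h
    · exact hz z' (by simp [h])
    · rcases List.mem_cons.1 h with rfl | h
      · exact hy
      · exact hz z' (by simp [h])
  simpa using hx _ hd

theorem length_flatMap_le {α β : Type} (zs : List (List α × β)) (m : ℕ)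
    (hz : ∀ z ∈ zs, z.1.length ≤ m) : (zs.flatMap Prod.fst).length ≤ zs.length * m := by
  rw [List.length_flatMap, ← List.length_map (as := zs) (fun z => z.1.length), ← smul_eq_mul]
  refine List.sum_le_card_nsmul _ _ fun n hn => ?_
  obtain ⟨z, hm, rfl⟩ := List.mem_map.1 hn
  exact hz z hm

theorem Derives.exists_useful_infix {k m : ℕ} (hk : ∀ r ∈ A.hor, r.1.length ≤ k) (hm : 2 ≤ m)
    {w : List S} {p : S ⊕ Q} (hd : A.Derives w p) (hu : A.Useful p) (hw : m ≤ w.length) :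
    ∃ y p', y <:+: w ∧ A.Derives y p' ∧ A.Useful p' ∧ m ≤ y.length ∧ y.length ≤ k * m := by
  induction hd with
  | letter a => simp at hw; omega
  | @hor q zs hq hz ih =>
    by_cases hlong : ∃ z ∈ zs, m ≤ z.1.length
    · obtain ⟨z, hzm, hl⟩ := hlong
      obtain ⟨y, p', hy, h⟩ := ih z hzm (hu.of_hor hq hz hzm) hl
      have hinf : z.1 <:+: zs.flatMap Prod.fst :=
        List.infix_of_mem_flatten (List.mem_map_of_mem hzm)
      exact ⟨y, p', hy.trans hinf, h⟩
    · push Not at hlong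
      refine ⟨_, _, List.infix_rfl, .hor zs hq hz, hu, hw, ?_⟩
      refine (length_flatMap_le zs m fun z h => (hlong z h).le).trans ?_
      exact Nat.mul_le_mul_right m (by simpa using hk _ hq)
  | ver hq _ h₂ ih _ =>
    obtain ⟨x, x', hx⟩ := hu
    exact ih ⟨x, x', fun y hy => hx y (.ver hq hy h₂)⟩ hw

theorem exists_hor_length_le (A : CF2HA S Q) : ∃ k, ∀ r ∈ A.hor, r.1.length ≤ k := by
  obtain ⟨k, hk⟩ := (A.hor_fin.image fun r => r.1.length).bddAbove
  exact ⟨k, fun r hr => hk ⟨r, hr, rfl⟩⟩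

end CF2HA

/-! ### Counting letters -/

/-- The sign with which a letter enters `letterDiff t`. -/
def letterSign (t a : Fin 3) : SignType := if a = t then 1 else if a = t + 1 then -1 else 0

/-- The number of occurrences of `t` minus the number of occurrences of `t + 1`. -/
def letterDiff (t : Fin 3) (w : List (Fin 3)) : ℤ := (w.map fun a => (letterSign t a : ℤ)).sum

@[simp] theorem letterDiff_nil (t : Fin 3) : letterDiff t [] = 0 := rfl

@[simp] theorem letterDiff_cons (t a : Fin 3) (w : List (Fin 3)) :
    letterDiff t (a :: w) = letterSign t a + letterDiff t w := by simp [letterDiff]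

@[simp] theorem letterDiff_append (t : Fin 3) (u v : List (Fin 3)) :
    letterDiff t (u ++ v) = letterDiff t u + letterDiff t v := by simp [letterDiff]

theorem letterDiff_eq_count (t : Fin 3) (w : List (Fin 3)) :
    letterDiff t w = w.count t - w.count (t + 1) := by
  induction w with
  | nil => simp
  | cons a w ih =>
    rw [letterDiff_cons, ih]
    simp only [List.count_cons]
    fin_cases t <;> fin_cases a <;> simp [letterSign] <;> ring

theorem length_eq_count (w : List (Fin 3)) :
    w.length = w.count 0 + w.count 1 + w.count 2 := by
  induction w with
  | nil => rfl
  | cons a w ih =>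
    simp only [List.count_cons, List.length_cons, ih]
    fin_cases a <;> simp <;> ring

/-- The word consisting of `n` letters `0`, then `n` letters `1`, then `n` letters `2`. -/
def threeBlocks (n : ℕ) : List (Fin 3) :=
  List.replicate n 0 ++ List.replicate n 1 ++ List.replicate n 2

theorem letterDiff_threeBlocks (t : Fin 3) (n : ℕ) : letterDiff t (threeBlocks n) = 0 := by
  rw [letterDiff_eq_count]
  fin_cases t <;> simp [threeBlocks, List.count_replicate]

theorem count_eq_zero_of_infix_threeBlocks {n : ℕ} {y : List (Fin 3)}
    (hy : y <:+: threeBlocks n) (hn : y.length < n) : y.count 0 = 0 ∨ y.count 2 = 0 := by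
  simp only [List.count_eq_zero]
  rcases List.infix_append_iff.1 hy with h | h | ⟨u, v, rfl, hu, hv⟩
  · exact Or.inr fun hm => by simpa using h.subset hm
  · exact Or.inl fun hm => by simpa using h.subset hm
  · have hu' : u <:+ List.replicate n 1 :=
      List.suffix_of_suffix_length_le hu (List.suffix_append _ _) (by simp at hn ⊢; omega)
    refine Or.inl fun hm => ?_
    rcases List.mem_append.1 hm with hm | hm
    · simpa using hu'.subset hm
    · simpa using hv.subset hm

/-! ### An automaton for unbalanced words -/

/-- The automaton accepting, among flat hedges, the words `w` with `letterDiff t w > 0` for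
some `t`: the state `(t, i)` stands for the words `w` with `i ≤ letterDiff t w`. -/
def unbalanced : CF2HA (Fin 3) (Fin 3 × SignType) where
  final := {q | q.2 = 1}
  hor :=
    (Set.range fun t : Fin 3 => ([], (t, 0))) ∪
    (Set.range fun x : Fin 3 × Fin 3 =>
      ([(Sum.inl x.2, true)], (x.1, letterSign x.1 x.2))) ∪
    ((fun x : Fin 3 × SignType × SignType × SignType =>
      ([(Sum.inr (x.1, x.2.1), true), (Sum.inr (x.1, x.2.2.1), true)], (x.1, x.2.2.2))) ''
      {x | (x.2.2.2 : ℤ) ≤ x.2.1 + x.2.2.1})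
  ver := ∅
  hor_fin := ((Set.finite_range _).union (Set.finite_range _)).union ((Set.toFinite _).image _)
  ver_fin := Set.finite_empty

namespace unbalanced

theorem derives_nil (t : Fin 3) : unbalanced.Derives [] (Sum.inr (t, 0)) :=
  .hor [] (Or.inl (Or.inl ⟨t, rfl⟩)) (by simp)

theorem derives_letter (t a : Fin 3) :
    unbalanced.Derives [a] (Sum.inr (t, letterSign t a)) := by
  refine .hor [([a], Sum.inl a, true)] (Or.inl (Or.inr ⟨(t, a), rfl⟩)) ?_
  simpa using .letter a

theorem derives_append {t : Fin 3} {i j k : SignType} {u v : List (Fin 3)}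
    (hu : unbalanced.Derives u (Sum.inr (t, i))) (hv : unbalanced.Derives v (Sum.inr (t, j)))
    (hk : (k : ℤ) ≤ i + j) : unbalanced.Derives (u ++ v) (Sum.inr (t, k)) := by
  have := CF2HA.Derives.hor (A := unbalanced) (q := (t, k))
    [(u, Sum.inr (t, i), true), (v, Sum.inr (t, j), true)]
    (Or.inr ⟨(t, i, j, k), hk, rfl⟩) (by simp [hu, hv])
  simpa using this

theorem le_letterDiff {w : List (Fin 3)} {p : Fin 3 ⊕ Fin 3 × SignType}
    (hd : unbalanced.Derives w p) :
    ∀ t i, (p = Sum.inr (t, i) → (i : ℤ) ≤ letterDiff t w) ∧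
      ∀ a, p = Sum.inl a → w = [a] := by
  induction hd with
  | letter a => simp
  | @hor q zs hq _ ih =>
    rintro t i
    refine ⟨?_, by simp⟩
    rintro ⟨⟩
    obtain (⟨s, hs⟩ | ⟨s, hs⟩) | ⟨s, hk, hs⟩ := hq
    · obtain ⟨h, rfl, rfl⟩ : [] = zs.map Prod.snd ∧ s = t ∧ 0 = i := by simpa using hs
      obtain rfl : zs = [] := by simpa using h.symm
      simp
    · obtain ⟨s, a⟩ := s
      simp only [Prod.mk.injEq] at hs
      obtain ⟨h, rfl, rfl⟩ := hs
      obtain ⟨⟨w, z⟩, rfl, rfl⟩ := List.map_eq_singleton_iff.1 h.symm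
      have := (ih (w, Sum.inl a, true) (by simp) 0 0).2 a rfl
      simp_all
    · obtain ⟨s, j, k, l⟩ := s
      simp only [Prod.mk.injEq] at hs
      obtain ⟨h, rfl, rfl⟩ := hs
      match zs, h, ih with
      | [(u, _), (v, _)], h, ih =>
        simp only [List.map_cons, List.map_nil, List.cons.injEq, and_true] at h
        obtain ⟨rfl, rfl⟩ := h
        have h₁ := (ih (u, Sum.inr (s, j), true) (by simp) s j).1 rfl
        have h₂ := (ih (v, Sum.inr (s, k), true) (by simp) s k).1 rfl
        simp at hk h₁ h₂ ⊢
        omega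
  | ver hq => exact absurd hq (by simp [unbalanced])

/-- `Power t i n w`: the word `w` is a concatenation of `n` words derived from `(t, i)`. -/
inductive Power (t : Fin 3) (i : SignType) : ℕ → List (Fin 3) → Prop where
  | zero : Power t i 0 []
  | succ {n : ℕ} {u v : List (Fin 3)} : unbalanced.Derives u (Sum.inr (t, i)) →
      Power t i n v → Power t i (n + 1) (u ++ v)

theorem exists_power (t : Fin 3) (w : List (Fin 3)) :
    ∃ (i : SignType) (n : ℕ) (u v : List (Fin 3)), i ≠ 0 ∧ w = u ++ v ∧
      letterDiff t w = i * n ∧ unbalanced.Derives u (Sum.inr (t, 0)) ∧ Power t i n v := by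
  induction w with
  | nil => exact ⟨1, 0, [], [], by simp, rfl, by simp, derives_nil t, .zero⟩
  | cons a w ih =>
    obtain ⟨i, n, u, v, hi, rfl, hdiff, hu, hv⟩ := ih
    have ha := derives_letter t a
    rw [letterDiff_cons, hdiff]
    generalize letterSign t a = s at ha
    have hau : unbalanced.Derives (a :: u) (Sum.inr (t, s)) := derives_append ha hu (by simp)
    rcases eq_or_ne s 0 with rfl | hs
    · exact ⟨i, n, a :: u, v, hi, rfl, by simp, hau, hv⟩
    rcases eq_or_ne s i with rfl | hsi
    · exact ⟨s, n + 1, [], a :: u ++ v, hi, rfl, by push_cast; ring, derives_nil t,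
        .succ hau hv⟩
    have hsum : (s : ℤ) + i = 0 := by revert hs hsi hi; clear * -; revert s i; decide
    cases hv with
    | zero => exact ⟨s, 1, [], a :: u ++ [], hs, rfl, by simp, derives_nil t, .succ hau .zero⟩
    | @succ n v₁ v₂ h₁ h₂ =>
      refine ⟨i, n, a :: u ++ v₁, v₂, hi, by simp, ?_, derives_append hau h₁ (by simp [hsum]),
        h₂⟩
      push_cast
      linear_combination hsum

theorem derives_of_power {t : Fin 3} {n : ℕ} {u v : List (Fin 3)} {i : SignType}
    (hu : unbalanced.Derives u (Sum.inr (t, i))) (hi : 0 ≤ i) (hv : Power t 1 n v)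
    (hn : i = 1 ∨ 0 < n) : unbalanced.Derives (u ++ v) (Sum.inr (t, 1)) := by
  induction hv generalizing u i with
  | zero => simpa [hn.resolve_right (lt_irrefl 0)] using hu
  | succ h₁ _ ih =>
    rw [← List.append_assoc]
    refine ih (i := 1) (derives_append hu h₁ ?_) (by decide) (Or.inl rfl)
    revert hi; cases i <;> decide

theorem mem_lang_iff (w : List (Fin 3)) :
    flatHedge w ∈ unbalanced.lang ↔ ∃ t, 0 < letterDiff t w := by
  rw [CF2HA.flatHedge_mem_lang_iff]
  constructor
  · rintro ⟨⟨t, i⟩, hi, hd⟩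
    obtain rfl : i = 1 := hi
    have := (le_letterDiff hd t 1).1 rfl
    exact ⟨t, by simp at this; omega⟩
  · rintro ⟨t, ht⟩
    refine ⟨(t, 1), rfl, ?_⟩
    obtain ⟨i, n, u, v, -, rfl, hdiff, hu, hv⟩ := exists_power t w
    rw [hdiff] at ht
    cases i with
    | zero => simp at ht
    | neg => simp at ht; omega
    | pos =>
      have hn : 0 < n := by simpa using ht
      exact derives_of_power hu le_rfl hv (Or.inr hn)

end unbalanced

theorem letterDiff_eq_zero {w : List (Fin 3)} (hw : ∀ t, letterDiff t w ≤ 0) (t : Fin 3) :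
    letterDiff t w = 0 := by
  simp only [letterDiff_eq_count] at hw ⊢
  have h0 := hw 0
  have h1 := hw 1
  have h2 := hw 2
  fin_cases t <;> simp at h0 h1 h2 ⊢ <;> omega

theorem exists_letterDiff_bound {Q : Type} [Finite Q] {A : CF2HA (Fin 3) Q}
    (hA : ∀ w, flatHedge w ∈ A.lang → ∀ t, letterDiff t w = 0) :
    ∃ B : ℕ, ∀ p, A.Useful p → ∀ y, A.Derives y p → ∀ t, |letterDiff t y| ≤ B := by
  have hp : ∀ x : (Fin 3 ⊕ Q) × Fin 3, ∃ B : ℕ, A.Useful x.1 → ∀ y, A.Derives y x.1 →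
      |letterDiff x.2 y| ≤ B := by
    rintro ⟨p, t⟩
    by_cases hu : A.Useful p
    · obtain ⟨x, z, hx⟩ := hu
      refine ⟨(|letterDiff t x + letterDiff t z|).toNat, fun _ y hy => ?_⟩
      have := hA _ (hx y hy) t
      simp only [letterDiff_append] at this
      rw [Int.toNat_of_nonneg (abs_nonneg _), ← abs_neg]
      exact (congrArg _ (by linarith)).le
    · exact ⟨0, fun h => absurd h hu⟩
  choose B hB using hp
  obtain ⟨C, hC⟩ := (Set.finite_range B).bddAbove
  refine ⟨C, fun p hu y hy t => (hB (p, t) hu y hy).trans ?_⟩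
  exact_mod_cast hC ⟨(p, t), rfl⟩

/-- The class of CF²HA languages is not closed under complementation
(complement taken inside `H(Σ)`, the set of ground hedges). -/
theorem cf2ha_not_closed_under_complement :
    ∃ (S : Type) (_ : Finite S) (Q₀ : Type) (_ : Finite Q₀) (A₀ : CF2HA S Q₀),
      ∀ (Q : Type) (_ : Finite Q) (A : CF2HA S Q),
        A.lang ≠ { h : VHedge S | Ground h ∧ h ∉ A₀.lang } := by
  refine ⟨Fin 3, inferInstance, Fin 3 × SignType, inferInstance, unbalanced, ?_⟩
  intro Q _ A hA
  have hmem : ∀ w, flatHedge w ∈ A.lang ↔ ∀ t, letterDiff t w ≤ 0 := fun w => by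
    rw [hA, Set.mem_ofPred_eq, unbalanced.mem_lang_iff]
    simp [CF2HA.ground_flatHedge]
  obtain ⟨B, hB⟩ := exists_letterDiff_bound (A := A) fun w hw t =>
    letterDiff_eq_zero ((hmem w).1 hw) t
  obtain ⟨k, hk⟩ := A.exists_hor_length_le
  set m := 3 * B + 2 with hm
  set n := k * m + m with hn
  obtain ⟨q, hq, hd⟩ := CF2HA.flatHedge_mem_lang_iff.1
    ((hmem (threeBlocks n)).2 fun t => (letterDiff_threeBlocks t n).le)
  obtain ⟨y, p, hy, hyp, hu, hlo, hhi⟩ := hd.exists_useful_infix hk (by omega)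
    (CF2HA.useful_of_mem_final hq) (m := m) (by simp [threeBlocks]; omega)
  have h0 := hB p hu y hyp 0
  have h1 := hB p hu y hyp 1
  rw [letterDiff_eq_count, abs_le] at h0 h1
  have hlen := length_eq_count y
  simp only [zero_add, show (1 + 1 : Fin 3) = 2 from rfl] at h0 h1
  rcases count_eq_zero_of_infix_threeBlocks hy (by omega) with h | h <;> omega
end

section
/- For every update parameterized hedge rewriting system R[A] over a finite alphabet Σ, there exist a loop-free update parameterized hedge rewriting system R̂[Â] over Σ and a map a ↦ â from Σ to Σ (extended homomorphically to hedges by relabeling every node) such that for all ground hedges h, h' ∈ H(Σ): h →*_{R[A]} h' if and only if ĥ →*_{R̂[Â]} ĥ'. -/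
/-- A hedge automaton in the sense of transitions `a(L) → q`, where `L ⊆ Q*` is
a word language. With all `L` regular this is a hedge automaton (HA), with all
`L` context-free it is a context-free hedge automaton (CFHA). -/
structure WordHA (S Q : Type) where
  final : Set Q
  trans : Set (S × Language Q × Q)
  trans_fin : trans.Finite

/-- All horizontal languages are regular: a hedge automaton. -/
def WordHA.IsHA {S Q : Type} (B : WordHA S Q) : Prop :=
  ∀ t ∈ B.trans, (t.2.1 : Language Q).IsRegular

/-- All horizontal languages are context-free: a context-free hedge automaton. -/
def WordHA.IsCFHA {S Q : Type} (B : WordHA S Q) : Prop :=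
  ∀ t ∈ B.trans, (t.2.1 : Language Q).IsContextFree

/-- The move relation: rewrite relation on ground hedges over `Σ ∪ Q` induced
by the transitions `a(L) → q`. -/
inductive WordHA.Step {S Q : Type} (B : WordHA S Q) :
    VHedge (S ⊕ Q) → VHedge (S ⊕ Q) → Prop where
  | trans {a : S} {L : Language Q} {q : Q} {w : List Q} :
      (a, L, q) ∈ B.trans → w ∈ L →
      WordHA.Step B
        [VTree.node (Sum.inl a) (w.map fun p => VTree.node (Sum.inr p) [])]
        [VTree.node (Sum.inr q) []]
  | ctx_hor {h h' : VHedge (S ⊕ Q)} (pre post : VHedge (S ⊕ Q)) :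
      WordHA.Step B h h' → WordHA.Step B (pre ++ h ++ post) (pre ++ h' ++ post)
  | ctx_ver {h h' : VHedge (S ⊕ Q)} (a : S ⊕ Q) :
      WordHA.Step B h h' → WordHA.Step B [VTree.node a h] [VTree.node a h']

/-- `L(B, q)`: ground hedges over `S` that reduce to `q(ε)`. -/
def WordHA.stateLang {S Q : Type} (B : WordHA S Q) (q : Q) : Set (VHedge S) :=
  { h | Ground h ∧
    Relation.ReflTransGen B.Step (hedgeMap Sum.inl h) [VTree.node (Sum.inr q) []] }

/-- `L(B)`: hedges accepted in some final state. -/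
def WordHA.lang {S Q : Type} (B : WordHA S Q) : Set (VHedge S) :=
  { h | ∃ q ∈ B.final, h ∈ B.stateLang q }

/-- Application of a substitution `σ : X → H(Σ, X)` to a tree, yielding a hedge
(a variable leaf is replaced by the hedge `σ x`). -/
def substT {α : Type} (σ : ℕ → VHedge α) : VTree α → VHedge α
  | .var x => σ x
  | .node a ts => [.node a ((ts.attach.map fun t => substT σ t.1).flatten)]
decreasing_by
  have := List.sizeOf_lt_of_mem t.2
  simp only [VTree.node.sizeOf_spec]
  omega

/-- Application of a substitution to a hedge. -/
def substH {α : Type} (σ : ℕ → VHedge α) (h : VHedge α) : VHedge α :=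
  (h.map (substT σ)).flatten

/-- The rewrite relation of a hedge rewriting system `R`: the smallest relation
containing `R` that is closed under application of substitutions and contexts. -/
inductive HRew {α : Type} (R : Set (VHedge α × VHedge α)) :
    VHedge α → VHedge α → Prop where
  | base {l r : VHedge α} (σ : ℕ → VHedge α) :
      (l, r) ∈ R → HRew R (substH σ l) (substH σ r)
  | ctx_hor {h h' : VHedge α} (pre post : VHedge α) :
      HRew R h h' → HRew R (pre ++ h ++ post) (pre ++ h' ++ post)
  | ctx_ver {h h' : VHedge α} (a : α) :
      HRew R h h' → HRew R [.node a h] [.node a h']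

/-- `post*_R(L)`: the forward rewrite closure of `L` under `R`. -/
def postStar {α : Type} (R : Set (VHedge α × VHedge α)) (L : Set (VHedge α)) :
    Set (VHedge α) :=
  { h' | ∃ h ∈ L, Relation.ReflTransGen (HRew R) h h' }

/-- The hedge of state leaves `q₁(ε)…qₙ(ε)` associated with a word `u ∈ Q*`. -/
def stateLeaves {S Q : Type} (u : List Q) : VHedge (S ⊕ Q) :=
  u.map fun p => VTree.node (Sum.inr p) []

/-- Instantiation of a right-hand side: every state leaf `p(ε)` is replaced by
an arbitrary ground hedge of `L(A, p)` (independently for each occurrence). -/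
inductive InstT {S Q : Type} (B : WordHA S Q) : VTree (S ⊕ Q) → VHedge S → Prop where
  | var (n : ℕ) : InstT B (.var n) [.var n]
  | state {q : Q} {h : VHedge S} : h ∈ B.stateLang q → InstT B (.node (Sum.inr q) []) h
  | node {a : S} {ts : List (VTree (S ⊕ Q))} {gs : List (VHedge S)} :
      List.Forall₂ (InstT B) ts gs → InstT B (.node (Sum.inl a) ts) [.node a gs.flatten]

/-- The (possibly infinite) HRS `R[A]` obtained from a parameterized HRS `R` by
replacing, in right-hand sides, each state `p` by a ground hedge of `L(A, p)`. -/
def instRules {S Q : Type} (B : WordHA S Q)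
    (R : Set (VHedge S × VHedge (S ⊕ Q))) : Set (VHedge S × VHedge S) :=
  { lr | ∃ (r : VHedge (S ⊕ Q)) (gs : List (VHedge S)),
      (lr.1, r) ∈ R ∧ List.Forall₂ (InstT B) r gs ∧ lr.2 = gs.flatten }

/-- Update rules: `(ren) a(x) → b(x)`, `(ac) a(x) → a(u₁ x u₂)`,
`(as) a(x) → v₁ a(x) v₂`, `(ap) a(x) → b(a(x))`, `(rpl) a(x) → u`,
`(del) a(x) → x`, where `u, uᵢ, vᵢ ∈ Q*`. -/
def IsUpdate {S Q : Type} (rule : VHedge S × VHedge (S ⊕ Q)) : Prop :=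
  ∃ (a : S) (x : ℕ), rule.1 = [VTree.node a [VTree.var x]] ∧
    ((∃ b : S, rule.2 = [VTree.node (Sum.inl b) [VTree.var x]]) ∨
     (∃ u₁ u₂ : List Q,
        rule.2 = [VTree.node (Sum.inl a) (stateLeaves u₁ ++ [VTree.var x] ++ stateLeaves u₂)]) ∨
     (∃ v₁ v₂ : List Q,
        rule.2 = stateLeaves v₁ ++ [VTree.node (Sum.inl a) [VTree.var x]] ++ stateLeaves v₂) ∨
     (∃ b : S, rule.2 = [VTree.node (Sum.inl b) [VTree.node (Sum.inl a) [VTree.var x]]]) ∨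
     (∃ u : List Q, rule.2 = stateLeaves u) ∨
     rule.2 = [VTree.var x])

/-- Loop-freeness: there is no cyclic sequence of renaming rules
`a₀(x) → a₁(x), …, a_{m-1}(x) → a_m(x)` in `R` with `a₀ = a_m`, `m ≥ 1`. -/
def LoopFree {S Q : Type} (R : Set (VHedge S × VHedge (S ⊕ Q))) : Prop :=
  ¬ ∃ (m : ℕ) (a : ℕ → S), 1 ≤ m ∧ a 0 = a m ∧
      ∀ i < m, ∃ x : ℕ,
        ([VTree.node (a i) [VTree.var x]],
         ([VTree.node (Sum.inl (a (i + 1))) [VTree.var x]] : VHedge (S ⊕ Q))) ∈ R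

theorem VTree.induction {α : Type} {P : VTree α → Prop} (var : ∀ n, P (.var n))
    (node : ∀ a ts, (∀ t ∈ ts, P t) → P (.node a ts)) : ∀ t, P t
  | .var n => var n
  | .node a ts => node a ts fun t _ => VTree.induction var node t

section Relabeling

variable {α β γ : Type}

@[simp] theorem VTree.map_var (f : α → β) (n : ℕ) : (VTree.var n).map f = .var n := by
  simp [VTree.map]

@[simp] theorem VTree.map_node (f : α → β) (a : α) (ts : VHedge α) :
    (VTree.node a ts).map f = .node (f a) (hedgeMap f ts) := by
  simp [VTree.map, hedgeMap]

@[simp] theorem hedgeMap_nil (f : α → β) : hedgeMap f [] = [] := rfl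

@[simp] theorem hedgeMap_cons (f : α → β) (t : VTree α) (h : VHedge α) :
    hedgeMap f (t :: h) = t.map f :: hedgeMap f h := rfl

@[simp] theorem hedgeMap_append (f : α → β) (h k : VHedge α) :
    hedgeMap f (h ++ k) = hedgeMap f h ++ hedgeMap f k := by
  simp [hedgeMap]

theorem hedgeMap_flatten (f : α → β) (gs : List (VHedge α)) :
    hedgeMap f gs.flatten = (gs.map (hedgeMap f)).flatten := by
  simp only [hedgeMap, List.map_flatten]
  rfl

@[simp] theorem hedgeMap_eq_nil {f : α → β} {h : VHedge α} : hedgeMap f h = [] ↔ h = [] := by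
  simp [hedgeMap]

theorem hedgeMap_eq_singleton {f : α → β} {h : VHedge α} {t : VTree β}
    (e : hedgeMap f h = [t]) : ∃ s, h = [s] ∧ s.map f = t := by
  simpa [hedgeMap, List.map_eq_singleton_iff] using e

theorem hedgeMap_eq_append {f : α → β} {h : VHedge α} {k₁ k₂ : VHedge β}
    (e : hedgeMap f h = k₁ ++ k₂) :
    ∃ h₁ h₂, h = h₁ ++ h₂ ∧ hedgeMap f h₁ = k₁ ∧ hedgeMap f h₂ = k₂ :=
  List.map_eq_append_iff.1 e

theorem VTree.map_eq_node {f : α → β} {t : VTree α} {b : β} {ts : VHedge β}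
    (e : t.map f = .node b ts) : ∃ a us, t = .node a us ∧ f a = b ∧ hedgeMap f us = ts := by
  cases t with
  | var n => simp at e
  | node a us =>
    simp only [VTree.map_node, VTree.node.injEq] at e
    exact ⟨a, us, rfl, e⟩

theorem VTree.map_eq_var {f : α → β} {t : VTree α} {n : ℕ}
    (e : t.map f = .var n) : t = .var n := by
  cases t with
  | var m => simpa using e
  | node a us => simp at e

theorem VTree.map_map (f : α → β) (g : β → γ) (t : VTree α) :
    (t.map f).map g = t.map (g ∘ f) := by
  induction t using VTree.induction with
  | var n => simp
  | node a ts ih =>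
    simp only [VTree.map_node, hedgeMap, List.map_map, Function.comp_apply, VTree.node.injEq,
      true_and, List.map_inj_left]
    exact ih

theorem hedgeMap_hedgeMap (f : α → β) (g : β → γ) (h : VHedge α) :
    hedgeMap g (hedgeMap f h) = hedgeMap (g ∘ f) h := by
  simp [hedgeMap, VTree.map_map]

theorem groundT_map {f : α → β} (t : VTree α) : GroundT (t.map f) ↔ GroundT t := by
  induction t using VTree.induction with
  | var n => simp only [VTree.map_var]; constructor <;> rintro ⟨⟩
  | node a ts ih =>
    rw [VTree.map_node]
    constructor
    · rintro ⟨h⟩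
      exact .node fun t ht => (ih t ht).1 (h _ (List.mem_map_of_mem ht))
    · rintro ⟨h⟩
      refine .node fun t ht => ?_
      obtain ⟨s, hs, rfl⟩ := List.mem_map.1 ht
      exact (ih s hs).2 (h s hs)

theorem ground_hedgeMap {f : α → β} (h : VHedge α) : Ground (hedgeMap f h) ↔ Ground h := by
  simp [Ground, hedgeMap, groundT_map]

end Relabeling

section Substitution

variable {α β : Type}

@[simp] theorem substT_var (σ : ℕ → VHedge α) (n : ℕ) : substT σ (.var n) = σ n := by
  simp [substT]

@[simp] theorem substT_node (σ : ℕ → VHedge α) (a : α) (ts : VHedge α) :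
    substT σ (.node a ts) = [.node a (substH σ ts)] := by
  simp [substT, substH]

@[simp] theorem substH_nil (σ : ℕ → VHedge α) : substH σ [] = [] := rfl

@[simp] theorem substH_cons (σ : ℕ → VHedge α) (t : VTree α) (h : VHedge α) :
    substH σ (t :: h) = substT σ t ++ substH σ h := rfl

theorem substH_append (σ : ℕ → VHedge α) (h k : VHedge α) :
    substH σ (h ++ k) = substH σ h ++ substH σ k := by
  simp [substH]

theorem substH_congr {σ τ : ℕ → VHedge α} {h : VHedge α}
    (H : ∀ t ∈ h, substT σ t = substT τ t) : substH σ h = substH τ h := by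
  rw [substH, substH, List.map_congr_left H]

theorem hedgeMap_substH_of_forall {f : α → β} {σ : ℕ → VHedge α} {h : VHedge α}
    (H : ∀ t ∈ h, hedgeMap f (substT σ t) = substT (hedgeMap f ∘ σ) (t.map f)) :
    hedgeMap f (substH σ h) = substH (hedgeMap f ∘ σ) (hedgeMap f h) := by
  induction h with
  | nil => rfl
  | cons t h ih => simp_all

theorem hedgeMap_substT (f : α → β) (σ : ℕ → VHedge α) (t : VTree α) :
    hedgeMap f (substT σ t) = substT (hedgeMap f ∘ σ) (t.map f) := by
  induction t using VTree.induction with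
  | var n => simp
  | node a ts ih => simp [hedgeMap_substH_of_forall ih]

theorem hedgeMap_substH (f : α → β) (σ : ℕ → VHedge α) (h : VHedge α) :
    hedgeMap f (substH σ h) = substH (hedgeMap f ∘ σ) (hedgeMap f h) :=
  hedgeMap_substH_of_forall fun t _ => hedgeMap_substT f σ t

theorem GroundT.substT_eq {σ τ : ℕ → VHedge α} (t : VTree α) (ht : GroundT t) :
    substT σ t = substT τ t := by
  induction t using VTree.induction with
  | var n => cases ht
  | node a ts ih =>
    obtain ⟨h⟩ := ht
    simp only [substT_node, substH_congr fun t ht => ih t ht (h t ht)]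

/-- `x` is the only variable that may occur in the tree. -/
inductive OnlyVar (x : ℕ) : VTree α → Prop where
  | var : OnlyVar x (.var x)
  | node {a : α} {ts : VHedge α} : (∀ t ∈ ts, OnlyVar x t) → OnlyVar x (.node a ts)

end Substitution

section Closure

variable {α : Type} {R : Set (VHedge α × VHedge α)}

theorem HRew.reflTransGen_ctx_hor {h h' : VHedge α} (pre post : VHedge α)
    (H : Relation.ReflTransGen (HRew R) h h') :
    Relation.ReflTransGen (HRew R) (pre ++ h ++ post) (pre ++ h' ++ post) :=
  Relation.ReflTransGen.lift (fun h => pre ++ h ++ post)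
    (fun _ _ hs => HRew.ctx_hor pre post hs) _ _ H

theorem HRew.reflTransGen_ctx_ver {h h' : VHedge α} (a : α)
    (H : Relation.ReflTransGen (HRew R) h h') :
    Relation.ReflTransGen (HRew R) [.node a h] [.node a h'] :=
  Relation.ReflTransGen.lift (fun h => [VTree.node a h])
    (fun _ _ hs => HRew.ctx_ver a hs) _ _ H

end Closure

section Automata

variable {S S' Q : Type}

/-- Relabeling of the letters read by a hedge automaton. -/
def WordHA.relabel (f : S → S') (A : WordHA S Q) : WordHA S' Q where
  final := A.final
  trans := (fun t => (f t.1, t.2)) '' A.trans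
  trans_fin := A.trans_fin.image _

theorem WordHA.IsHA.relabel {A : WordHA S Q} (hA : A.IsHA) (f : S → S') :
    (A.relabel f).IsHA := by
  rintro _ ⟨t, ht, rfl⟩
  exact hA t ht

theorem hedgeMap_stateLeaves (f : S → S') (u : List Q) :
    hedgeMap (Sum.map f id) (stateLeaves u : VHedge (S ⊕ Q)) = stateLeaves u := by
  simp [hedgeMap, stateLeaves]

theorem WordHA.Step.relabel {A : WordHA S Q} (f : S → S') {h h' : VHedge (S ⊕ Q)}
    (H : A.Step h h') :
    (A.relabel f).Step (hedgeMap (Sum.map f id) h) (hedgeMap (Sum.map f id) h') := by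
  induction H with
  | @trans a L q w ht hw =>
    have := WordHA.Step.trans (B := A.relabel f) (a := f a) (q := q) ⟨_, ht, rfl⟩ hw
    have e := hedgeMap_stateLeaves f w
    simp only [stateLeaves] at e
    simpa [e] using this
  | ctx_hor pre post _ ih => simpa using ih.ctx_hor _ _
  | ctx_ver a _ ih => simpa using ih.ctx_ver _

theorem hedgeMap_eq_stateLeaf {f : S → S'} {g : VHedge (S ⊕ Q)} {q : Q}
    (e : hedgeMap (Sum.map f id) g = [.node (Sum.inr q) []]) : g = [.node (Sum.inr q) []] := by
  obtain ⟨s, rfl, hs⟩ := hedgeMap_eq_singleton e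
  obtain ⟨a, us, rfl, ha, hu⟩ := VTree.map_eq_node hs
  cases a <;> simp_all

theorem WordHA.Step.exists_of_relabel {A : WordHA S Q} {f : S → S'} {k k' : VHedge (S' ⊕ Q)}
    (H : (A.relabel f).Step k k') : ∀ g', hedgeMap (Sum.map f id) g' = k' →
      ∃ g, hedgeMap (Sum.map f id) g = k ∧ A.Step g g' := by
  induction H with
  | @trans a L q w ht hw =>
    intro g' e
    obtain ⟨⟨c, L', q'⟩, ht, e'⟩ := ht
    simp only [Prod.mk.injEq] at e'
    obtain ⟨rfl, rfl, rfl⟩ := e'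
    rw [hedgeMap_eq_stateLeaf e]
    refine ⟨_, ?_, WordHA.Step.trans ht hw⟩
    have e := hedgeMap_stateLeaves f w
    simp only [stateLeaves] at e
    simp [e]
  | ctx_hor pre post _ ih =>
    intro g' e
    obtain ⟨l, post', rfl, h₁, rfl⟩ := hedgeMap_eq_append e
    obtain ⟨pre', m, rfl, rfl, h₂⟩ := hedgeMap_eq_append h₁
    obtain ⟨g, rfl, H⟩ := ih m h₂
    exact ⟨pre' ++ g ++ post', by simp, H.ctx_hor _ _⟩
  | ctx_ver a _ ih =>
    intro g' e
    obtain ⟨s, rfl, hs⟩ := hedgeMap_eq_singleton e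
    obtain ⟨c, us, rfl, rfl, hu⟩ := VTree.map_eq_node hs
    obtain ⟨g, rfl, H⟩ := ih us hu
    exact ⟨[.node c g], by simp, H.ctx_ver _⟩

theorem hedgeMap_inl_lift_of_forall {f : S → S'} {h : VHedge S'}
    (H : ∀ t ∈ h, ∀ s : VTree (S ⊕ Q), s.map (Sum.map f id) = t.map Sum.inl →
      ∃ s' : VTree S, s = s'.map Sum.inl ∧ s'.map f = t) :
    ∀ g : VHedge (S ⊕ Q), hedgeMap (Sum.map f id) g = hedgeMap Sum.inl h →
      ∃ g' : VHedge S, g = hedgeMap Sum.inl g' ∧ hedgeMap f g' = h := by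
  induction h with
  | nil => intro g e; exact ⟨[], by simpa using e, rfl⟩
  | cons t h ih =>
    intro g e
    cases g with
    | nil => simp at e
    | cons s g =>
      simp only [hedgeMap_cons, List.cons.injEq] at e
      obtain ⟨s', rfl, rfl⟩ := H t (by simp) s e.1
      obtain ⟨g', rfl, rfl⟩ := ih (fun t ht => H t (by simp [ht])) g e.2
      exact ⟨s' :: g', rfl, rfl⟩

theorem VTree.map_inl_lift {f : S → S'} (t : VTree S') :
    ∀ s : VTree (S ⊕ Q), s.map (Sum.map f id) = t.map Sum.inl →
      ∃ s' : VTree S, s = s'.map Sum.inl ∧ s'.map f = t := by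
  induction t using VTree.induction with
  | var n =>
    intro s e
    rw [VTree.map_var] at e
    exact ⟨.var n, by simpa using VTree.map_eq_var e, by simp⟩
  | node a ts ih =>
    intro s e
    rw [VTree.map_node] at e
    obtain ⟨c, us, rfl, hc, hu⟩ := VTree.map_eq_node e
    obtain ⟨us', rfl, rfl⟩ := hedgeMap_inl_lift_of_forall ih us hu
    cases c with
    | inl c =>
      simp only [Sum.map_inl, Sum.inl.injEq] at hc
      exact ⟨.node c us', by simp, by simp [hc]⟩
    | inr q => simp at hc

theorem WordHA.mem_stateLang_relabel {A : WordHA S Q} {f : S → S'} {q : Q} {k : VHedge S'} :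
    k ∈ (A.relabel f).stateLang q ↔ ∃ h ∈ A.stateLang q, hedgeMap f h = k := by
  constructor
  · rintro ⟨hk, H⟩
    have key : ∀ m : VHedge (S' ⊕ Q),
        Relation.ReflTransGen (A.relabel f).Step m [.node (Sum.inr q) []] →
        ∃ g, hedgeMap (Sum.map f id) g = m ∧
          Relation.ReflTransGen A.Step g [.node (Sum.inr q) []] := by
      intro m hm
      induction hm using Relation.ReflTransGen.head_induction_on with
      | refl => exact ⟨_, by simp, .refl⟩
      | head hs _ ih =>
        obtain ⟨g, e, hg⟩ := ih
        obtain ⟨g₀, rfl, hs₀⟩ := hs.exists_of_relabel g e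
        exact ⟨g₀, rfl, .head hs₀ hg⟩
    obtain ⟨g, e, hg⟩ := key _ H
    obtain ⟨g', rfl, rfl⟩ := hedgeMap_inl_lift_of_forall (fun t _ => t.map_inl_lift) g e
    exact ⟨g', ⟨(ground_hedgeMap g').1 hk, hg⟩, rfl⟩
  · rintro ⟨h, ⟨hg, H⟩, rfl⟩
    refine ⟨(ground_hedgeMap h).2 hg, ?_⟩
    have := Relation.ReflTransGen.lift (hedgeMap (Sum.map f id))
      (fun _ _ hs => WordHA.Step.relabel f hs) _ _ H
    rw [Function.onFun, hedgeMap_hedgeMap] at this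
    rw [hedgeMap_hedgeMap]
    have e : (Sum.map f id ∘ Sum.inl : S → S' ⊕ Q) = Sum.inl ∘ f := rfl
    simpa [e] using this

end Automata

section Instances

variable {S S' Q : Type} {A : WordHA S Q} {f : S → S'}

theorem forall₂_instT_relabel_of_forall {r : VHedge (S ⊕ Q)}
    (H : ∀ t ∈ r, ∀ g, InstT A t g → InstT (A.relabel f) (t.map (Sum.map f id)) (hedgeMap f g))
    {gs : List (VHedge S)} (h : List.Forall₂ (InstT A) r gs) :
    List.Forall₂ (InstT (A.relabel f)) (hedgeMap (Sum.map f id) r) (gs.map (hedgeMap f)) := by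
  induction h with
  | nil => exact .nil
  | cons h _ ih => exact .cons (H _ (by simp) _ h) (ih fun t ht => H t (by simp [ht]))

theorem InstT.relabel (f : S → S') (t : VTree (S ⊕ Q)) :
    ∀ g, InstT A t g → InstT (A.relabel f) (t.map (Sum.map f id)) (hedgeMap f g) := by
  induction t using VTree.induction with
  | var n => rintro _ ⟨⟩; simpa using InstT.var n
  | node a ts ih =>
    intro g h
    cases h with
    | state h => simpa using InstT.state (WordHA.mem_stateLang_relabel.2 ⟨_, h, rfl⟩)
    | node h =>
      simpa [hedgeMap_flatten] using InstT.node (forall₂_instT_relabel_of_forall ih h)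

theorem forall₂_instT_of_relabel_of_forall {r : VHedge (S ⊕ Q)}
    (H : ∀ t ∈ r, ∀ k, InstT (A.relabel f) (t.map (Sum.map f id)) k →
      ∃ g, InstT A t g ∧ hedgeMap f g = k) :
    ∀ {ks : List (VHedge S')},
      List.Forall₂ (InstT (A.relabel f)) (hedgeMap (Sum.map f id) r) ks →
      ∃ gs, List.Forall₂ (InstT A) r gs ∧ gs.map (hedgeMap f) = ks := by
  induction r with
  | nil => rintro _ ⟨⟩; exact ⟨[], .nil, rfl⟩
  | cons t r ih =>
    intro ks h
    cases h with
    | cons h hs =>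
      obtain ⟨g, hg, rfl⟩ := H t (by simp) _ h
      obtain ⟨gs, hgs, rfl⟩ := ih (fun t ht => H t (by simp [ht])) hs
      exact ⟨g :: gs, .cons hg hgs, rfl⟩

theorem InstT.exists_of_relabel (t : VTree (S ⊕ Q)) :
    ∀ k, InstT (A.relabel f) (t.map (Sum.map f id)) k →
      ∃ g, InstT A t g ∧ hedgeMap f g = k := by
  induction t using VTree.induction with
  | var n =>
    intro k h
    rw [VTree.map_var] at h
    cases h
    exact ⟨_, .var n, by simp⟩
  | node a ts ih =>
    intro k h
    rw [VTree.map_node] at h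
    generalize hts : hedgeMap (Sum.map f id) ts = us at h
    cases a with
    | inl a =>
      cases h with
      | node h =>
        subst hts
        obtain ⟨gs, hgs, rfl⟩ := forall₂_instT_of_relabel_of_forall ih h
        exact ⟨_, .node hgs, by simp [hedgeMap_flatten]⟩
    | inr q =>
      cases h with
      | state h =>
        obtain rfl := hedgeMap_eq_nil.1 hts
        obtain ⟨g, hg, rfl⟩ := WordHA.mem_stateLang_relabel.1 h
        exact ⟨g, .state hg, rfl⟩

theorem substH_flatten_eq_of_forall {σ τ : ℕ → VHedge S} {r : VHedge (S ⊕ Q)}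
    (H : ∀ t ∈ r, ∀ g, InstT A t g → substH σ g = substH τ g)
    {gs : List (VHedge S)} (h : List.Forall₂ (InstT A) r gs) :
    substH σ gs.flatten = substH τ gs.flatten := by
  induction h with
  | nil => rfl
  | cons h _ ih =>
    rw [List.flatten_cons, substH_append, substH_append, H _ (by simp) _ h,
      ih fun t ht => H t (by simp [ht])]

theorem InstT.substH_eq {x : ℕ} {σ τ : ℕ → VHedge S} (hx : σ x = τ x) (t : VTree (S ⊕ Q))
    (ht : OnlyVar x t) : ∀ g, InstT A t g → substH σ g = substH τ g := by
  induction t using VTree.induction with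
  | var n => cases ht; rintro _ ⟨⟩; simpa using hx
  | node a ts ih =>
    obtain _ | ⟨ht⟩ := ht
    intro g h
    cases h with
    | state h => exact substH_congr fun t ht => (h.1 t ht).substT_eq
    | node h => simp [substH_flatten_eq_of_forall (fun t hm => ih t hm (ht t hm)) h]

end Instances

section Rules

variable {S S' Q : Type}

/-- Relabeling of the symbols of a parameterized rewrite rule. -/
def relabelRule (f : S → S') (rule : VHedge S × VHedge (S ⊕ Q)) :
    VHedge S' × VHedge (S' ⊕ Q) :=
  (hedgeMap f rule.1, hedgeMap (Sum.map f id) rule.2)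

theorem IsUpdate.relabel (f : S → S') {rule : VHedge S × VHedge (S ⊕ Q)} (h : IsUpdate rule) :
    IsUpdate (relabelRule f rule) := by
  obtain ⟨l, r⟩ := rule
  obtain ⟨a, x, hl, hr⟩ := h
  dsimp only at hl hr
  subst hl
  refine ⟨f a, x, by simp [relabelRule], ?_⟩
  rcases hr with ⟨b, rfl⟩ | ⟨u, v, rfl⟩ | ⟨u, v, rfl⟩ | ⟨b, rfl⟩ | ⟨u, rfl⟩ | rfl
  · exact .inl ⟨f b, by simp [relabelRule]⟩
  · exact .inr (.inl ⟨u, v, by simp [relabelRule, hedgeMap_stateLeaves]⟩)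
  · exact .inr (.inr (.inl ⟨u, v, by simp [relabelRule, hedgeMap_stateLeaves]⟩))
  · exact .inr (.inr (.inr (.inl ⟨f b, by simp [relabelRule]⟩)))
  · exact .inr (.inr (.inr (.inr (.inl ⟨u, by simp [relabelRule, hedgeMap_stateLeaves]⟩))))
  · exact .inr (.inr (.inr (.inr (.inr (by simp [relabelRule])))))

theorem onlyVar_of_mem_stateLeaves {x : ℕ} {u : List Q} {t : VTree (S ⊕ Q)}
    (h : t ∈ (stateLeaves u : VHedge (S ⊕ Q))) : OnlyVar x t := by
  obtain ⟨q, _, rfl⟩ := List.mem_map.1 h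
  exact .node (by simp)

theorem onlyVar_node_var (x : ℕ) (a : S) : OnlyVar x (.node a [.var x]) :=
  .node fun t ht => by
    obtain rfl := List.mem_singleton.1 ht
    exact .var

theorem IsUpdate.onlyVar {l : VHedge S} {r : VHedge (S ⊕ Q)} (h : IsUpdate (l, r)) :
    ∃ a x, l = [.node a [.var x]] ∧ ∀ t ∈ r, OnlyVar x t := by
  obtain ⟨a, x, hl, hr⟩ := h
  dsimp only at hl hr
  refine ⟨a, x, hl, ?_⟩
  rcases hr with ⟨b, rfl⟩ | ⟨u, v, rfl⟩ | ⟨u, v, rfl⟩ | ⟨b, rfl⟩ | ⟨u, rfl⟩ | rfl <;> intro t ht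
  · obtain rfl := List.mem_singleton.1 ht
    exact onlyVar_node_var x _
  · obtain rfl := List.mem_singleton.1 ht
    refine .node fun s hs => ?_
    simp only [List.mem_append, List.mem_singleton] at hs
    rcases hs with (hs | rfl) | hs
    exacts [onlyVar_of_mem_stateLeaves hs, .var, onlyVar_of_mem_stateLeaves hs]
  · simp only [List.mem_append, List.mem_singleton] at ht
    rcases ht with (ht | rfl) | ht
    exacts [onlyVar_of_mem_stateLeaves ht, onlyVar_node_var x _, onlyVar_of_mem_stateLeaves ht]
  · obtain rfl := List.mem_singleton.1 ht
    refine .node fun s hs => ?_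
    obtain rfl := List.mem_singleton.1 hs
    exact onlyVar_node_var x _
  · exact onlyVar_of_mem_stateLeaves ht
  · obtain rfl := List.mem_singleton.1 ht
    exact .var

/-- The trivial renaming rules `a(x) → a(x)`. -/
def trivialRenamings (S Q : Type) : Set (VHedge S × VHedge (S ⊕ Q)) :=
  { rule | ∃ (a : S) (x : ℕ),
      rule = ([.node a [.var x]], [.node (Sum.inl a) [.var x]]) }

/-- The image of a set of rules under a relabeling, without trivial renamings. -/
def relabelRules (f : S → S') (R : Set (VHedge S × VHedge (S ⊕ Q))) :
    Set (VHedge S' × VHedge (S' ⊕ Q)) :=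
  (relabelRule f '' R) \ trivialRenamings S' Q

/-- `a(x) → b(x)` is a rule of `R`, for some variable `x`. -/
def Renames (R : Set (VHedge S × VHedge (S ⊕ Q))) (a b : S) : Prop :=
  ∃ x : ℕ, (([.node a [.var x]], [.node (Sum.inl b) [.var x]]) :
    VHedge S × VHedge (S ⊕ Q)) ∈ R

/-- Two symbols are equivalent if each can be renamed into the other. -/
def renamingSetoid (R : Set (VHedge S × VHedge (S ⊕ Q))) : Setoid S where
  r a b := Relation.ReflTransGen (Renames R) a b ∧ Relation.ReflTransGen (Renames R) b a
  iseqv := ⟨fun _ => ⟨.refl, .refl⟩, fun h => ⟨h.2, h.1⟩,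
    fun h k => ⟨h.1.trans k.1, k.2.trans h.2⟩⟩

/-- A representative of the renaming class of a symbol. -/
noncomputable def renamingRep (R : Set (VHedge S × VHedge (S ⊕ Q))) (a : S) : S :=
  (Quotient.mk (renamingSetoid R) a).out

variable {R : Set (VHedge S × VHedge (S ⊕ Q))}

theorem renamingRep_rel (a : S) : renamingSetoid R (renamingRep R a) a :=
  Quotient.mk_out (s := renamingSetoid R) a

theorem renamingRep_eq_iff {a b : S} :
    renamingRep R a = renamingRep R b ↔ renamingSetoid R a b := by
  refine ⟨fun h => ?_, fun h => ?_⟩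
  · have ha := renamingRep_rel (R := R) a
    rw [h] at ha
    exact (renamingSetoid R).trans ((renamingSetoid R).symm ha) (renamingRep_rel b)
  · exact congrArg Quotient.out (Quotient.sound (s := renamingSetoid R) h)

theorem Renames.of_relabelRules {f : S → S'} {a b : S'} (h : Renames (relabelRules f R) a b) :
    a ≠ b ∧ ∃ c d, f c = a ∧ f d = b ∧ Renames R c d := by
  obtain ⟨x, ⟨⟨l, r⟩, hlr, e⟩, hne⟩ := h
  refine ⟨?_, ?_⟩
  · rintro rfl
    exact hne ⟨a, x, rfl⟩
  · simp only [relabelRule, Prod.mk.injEq] at e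
    obtain ⟨s, rfl, hs⟩ := hedgeMap_eq_singleton e.1
    obtain ⟨c, us, rfl, hc, hu⟩ := VTree.map_eq_node hs
    obtain ⟨s, rfl, hv⟩ := hedgeMap_eq_singleton hu
    obtain rfl := VTree.map_eq_var hv
    obtain ⟨s, rfl, hs⟩ := hedgeMap_eq_singleton e.2
    obtain ⟨d, us, rfl, hd, hu⟩ := VTree.map_eq_node hs
    obtain ⟨s, rfl, hv⟩ := hedgeMap_eq_singleton hu
    obtain rfl := VTree.map_eq_var hv
    cases d with
    | inl d => exact ⟨c, d, hc, by simpa using hd, x, hlr⟩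
    | inr q => simp at hd

theorem loopFree_relabelRules_renamingRep (R : Set (VHedge S × VHedge (S ⊕ Q))) :
    LoopFree (relabelRules (renamingRep R) R) := by
  rintro ⟨m, a, hm, he, H⟩
  have step : ∀ i < m, Relation.ReflTransGen (Renames R) (a i) (a (i + 1)) := by
    intro i hi
    obtain ⟨_, c, d, hc, hd, hcd⟩ := Renames.of_relabelRules (H i hi)
    rw [← hc, ← hd]
    exact ((renamingRep_rel c).1.tail hcd).trans (renamingRep_rel d).2
  have back : ∀ i, 1 ≤ i → i ≤ m → Relation.ReflTransGen (Renames R) (a 1) (a i) := by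
    intro i hi
    induction i, hi using Nat.le_induction with
    | base => exact fun _ => .refl
    | succ i _ ih => exact fun h => (ih (by omega)).trans (step i (by omega))
  obtain ⟨hne, c, d, hc, hd, _⟩ := Renames.of_relabelRules (H 0 hm)
  have hrel : renamingSetoid R (a 0) (a 1) := ⟨step 0 hm, by
    have := back m hm le_rfl
    rwa [← he] at this⟩
  refine hne ?_
  rw [zero_add] at hd ⊢
  have hc' := renamingRep_rel (R := R) c
  have hd' := renamingRep_rel (R := R) d
  rw [hc] at hc'
  rw [hd] at hd'
  rw [← hc, ← hd, renamingRep_eq_iff]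
  exact (renamingSetoid R).trans ((renamingSetoid R).symm hc')
    ((renamingSetoid R).trans hrel hd')

end Rules

section Simulation

variable {S S' Q : Type} {A : WordHA S Q} {R : Set (VHedge S × VHedge (S ⊕ Q))}

theorem HRew.relabel (f : S → S') {h h' : VHedge S} (H : HRew (instRules A R) h h') :
    Relation.ReflTransGen (HRew (instRules (A.relabel f) (relabelRules f R)))
      (hedgeMap f h) (hedgeMap f h') := by
  induction H with
  | @base l _ σ hlr =>
    obtain ⟨r, gs, hmem, hgs, e⟩ := hlr
    dsimp only at hmem e
    subst e
    have hgs' := forall₂_instT_relabel_of_forall (f := f) (fun t _ => InstT.relabel f t) hgs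
    rw [hedgeMap_substH, hedgeMap_substH]
    by_cases ht : relabelRule f (l, r) ∈ trivialRenamings S' Q
    · obtain ⟨a, x, e⟩ := ht
      simp only [relabelRule, Prod.mk.injEq] at e
      rw [e.2] at hgs'
      have e' : (gs.map (hedgeMap f)).flatten = [.node a [.var x]] := by
        generalize gs.map (hedgeMap f) = ks at hgs'
        cases hgs' with
        | cons hk hnil =>
          cases hnil
          cases hk with
          | node hk =>
            cases hk with
            | cons hv hnil =>
              cases hnil
              cases hv
              rfl
      rw [hedgeMap_flatten, e', e.1]
    · refine .single (HRew.base _ ⟨_, _, ⟨⟨_, hmem, rfl⟩, ht⟩, hgs', ?_⟩)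
      exact hedgeMap_flatten f gs
  | ctx_hor pre post _ ih =>
    simp only [hedgeMap_append]
    exact HRew.reflTransGen_ctx_hor _ _ ih
  | ctx_ver a _ ih =>
    simp only [hedgeMap_cons, hedgeMap_nil, VTree.map_node]
    exact HRew.reflTransGen_ctx_ver _ ih

theorem Renames.rew {a b : S} (h : Renames R a b) (k : VHedge S) :
    HRew (instRules A R) [.node a k] [.node b k] := by
  obtain ⟨x, hx⟩ := h
  have := HRew.base (R := instRules A R) (l := [.node a [.var x]]) (r := [.node b [.var x]])
    (fun _ => k) ⟨_, [[.node b [.var x]]], hx, .cons (.node (.cons (.var x) .nil)) .nil, rfl⟩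
  simpa using this

theorem reflTransGen_rew_of_renames {a b : S} (h : Relation.ReflTransGen (Renames R) a b)
    (k : VHedge S) :
    Relation.ReflTransGen (HRew (instRules A R)) [.node a k] [.node b k] :=
  Relation.ReflTransGen.lift (fun a => [VTree.node a k]) (fun _ _ hs => hs.rew k) _ _ h

theorem reflTransGen_rew_of_forall {R : Set (VHedge S × VHedge S)} {f : S → S'} {g : VHedge S}
    (H : ∀ t ∈ g, ∀ t', t.map f = t'.map f → Relation.ReflTransGen (HRew R) [t] [t']) :
    ∀ g', hedgeMap f g = hedgeMap f g' → Relation.ReflTransGen (HRew R) g g' := by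
  induction g with
  | nil =>
    intro g' e
    obtain rfl := hedgeMap_eq_nil.1 e.symm
    exact .refl
  | cons t g ih =>
    intro g' e
    cases g' with
    | nil => simp at e
    | cons t' g' =>
      simp only [hedgeMap_cons, List.cons.injEq] at e
      have h₁ := HRew.reflTransGen_ctx_hor [] g (H t (by simp) t' e.1)
      have h₂ := HRew.reflTransGen_ctx_hor [t'] [] (ih (fun t ht => H t (by simp [ht])) g' e.2)
      simp only [List.nil_append, List.append_nil, List.cons_append] at h₁ h₂
      exact h₁.trans h₂

theorem reflTransGen_rew_of_map_eq (t : VTree S) :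
    ∀ t', t.map (renamingRep R) = t'.map (renamingRep R) →
      Relation.ReflTransGen (HRew (instRules A R)) [t] [t'] := by
  induction t using VTree.induction with
  | var n =>
    intro t' e
    rw [VTree.map_var] at e
    rw [VTree.map_eq_var e.symm]
  | node a ts ih =>
    intro t' e
    rw [VTree.map_node] at e
    obtain ⟨c, us, rfl, hc, hu⟩ := VTree.map_eq_node e.symm
    exact (HRew.reflTransGen_ctx_ver a (reflTransGen_rew_of_forall ih us hu.symm)).trans
      (reflTransGen_rew_of_renames (renamingRep_eq_iff.1 hc).2 us)

theorem HRew.exists_of_relabel (hupd : ∀ rule ∈ R, IsUpdate rule) {k k' : VHedge S}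
    (H : HRew (instRules (A.relabel (renamingRep R)) (relabelRules (renamingRep R) R)) k k') :
    ∀ g, hedgeMap (renamingRep R) g = k → ∃ g', hedgeMap (renamingRep R) g' = k' ∧
      Relation.ReflTransGen (HRew (instRules A R)) g g' := by
  induction H with
  | base σ hlr =>
    intro g hg
    obtain ⟨r', ks, ⟨⟨⟨l, r⟩, hmem, e⟩, -⟩, hks, e'⟩ := hlr
    dsimp only at e e' hks
    simp only [relabelRule, Prod.mk.injEq] at e
    obtain ⟨rfl, rfl⟩ := e
    subst e'
    obtain ⟨b, y, e, honly⟩ := ((hupd _ hmem).relabel (renamingRep R)).onlyVar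
    obtain ⟨s, rfl, hs⟩ := hedgeMap_eq_singleton e
    obtain ⟨a, us, rfl, rfl, hu⟩ := VTree.map_eq_node hs
    obtain ⟨s, rfl, hv⟩ := hedgeMap_eq_singleton hu
    obtain rfl := VTree.map_eq_var hv
    rw [e] at hg
    simp only [substH_cons, substH_nil, substT_node, substT_var, List.append_nil] at hg
    obtain ⟨s, rfl, hs⟩ := hedgeMap_eq_singleton hg
    obtain ⟨c, h, rfl, hc, hh⟩ := VTree.map_eq_node hs
    obtain ⟨gs, hgs, rfl⟩ :=
      forall₂_instT_of_relabel_of_forall (fun t _ => InstT.exists_of_relabel t) hks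
    refine ⟨substH (fun _ => h) gs.flatten, ?_, ?_⟩
    · rw [hedgeMap_substH, hedgeMap_flatten]
      exact substH_flatten_eq_of_forall
        (fun t ht => InstT.substH_eq (x := y) (by simpa using hh) t (honly t ht)) hks
    · refine (reflTransGen_rew_of_renames (renamingRep_eq_iff.1 hc).1 h).tail ?_
      have := HRew.base (R := instRules A R) (fun _ => h) ⟨r, gs, hmem, hgs, rfl⟩
      simpa using this
  | ctx_hor pre post _ ih =>
    intro g e
    obtain ⟨l, post', rfl, h₁, rfl⟩ := hedgeMap_eq_append e
    obtain ⟨pre', m, rfl, rfl, h₂⟩ := hedgeMap_eq_append h₁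
    obtain ⟨g', rfl, H⟩ := ih m h₂
    exact ⟨pre' ++ g' ++ post', by simp, HRew.reflTransGen_ctx_hor _ _ H⟩
  | ctx_ver a _ ih =>
    intro g e
    obtain ⟨s, rfl, hs⟩ := hedgeMap_eq_singleton e
    obtain ⟨c, us, rfl, rfl, hu⟩ := VTree.map_eq_node hs
    obtain ⟨g', rfl, H⟩ := ih us hu
    exact ⟨[.node c g'], by simp, HRew.reflTransGen_ctx_ver _ H⟩

end Simulation

/-- Every update PHRS can be replaced by a loop-free one, up to a relabeling
`a ↦ â` of the alphabet applied homomorphically to hedges: for all ground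
hedges `h, h'`, `h →*_{R[A]} h'` iff `ĥ →*_{R̂[Â]} ĥ'`. -/
theorem uphrs_to_loopfree {S Q : Type} [Finite S] [Finite Q]
    (A : WordHA S Q) (hA : A.IsHA)
    (R : Set (VHedge S × VHedge (S ⊕ Q))) (hfin : R.Finite)
    (hupd : ∀ rule ∈ R, IsUpdate rule) :
    ∃ (Q' : Type) (_ : Finite Q') (Ahat : WordHA S Q')
      (Rhat : Set (VHedge S × VHedge (S ⊕ Q'))) (hat : S → S),
      Ahat.IsHA ∧ Rhat.Finite ∧ (∀ rule ∈ Rhat, IsUpdate rule) ∧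
      LoopFree Rhat ∧
      ∀ h h' : VHedge S, Ground h → Ground h' →
        (Relation.ReflTransGen (HRew (instRules A R)) h h' ↔
         Relation.ReflTransGen (HRew (instRules Ahat Rhat))
           (hedgeMap hat h) (hedgeMap hat h')) := by
  refine ⟨Q, ‹_›, A.relabel (renamingRep R), relabelRules (renamingRep R) R, renamingRep R,
    hA.relabel _, (hfin.image _).subset Set.sdiff_subset, ?_,
    loopFree_relabelRules_renamingRep R, fun h h' _ _ => ⟨fun H => ?_, fun H => ?_⟩⟩
  · rintro _ ⟨⟨rule, hrule, rfl⟩, -⟩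
    exact (hupd rule hrule).relabel _
  · exact Relation.ReflTransGen.lift' (hedgeMap (renamingRep R))
      (fun _ _ hs => HRew.relabel _ hs) _ _ H
  · have key : ∀ k, Relation.ReflTransGen (HRew (instRules (A.relabel (renamingRep R))
        (relabelRules (renamingRep R) R))) (hedgeMap (renamingRep R) h) k →
        ∃ g, hedgeMap (renamingRep R) g = k ∧
          Relation.ReflTransGen (HRew (instRules A R)) h g := by
      intro k hk
      induction hk with
      | refl => exact ⟨h, rfl, .refl⟩
      | tail _ hs ih =>
        obtain ⟨g, e, hg⟩ := ih
        obtain ⟨g', e', hg'⟩ := hs.exists_of_relabel hupd g e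
        exact ⟨g', e', hg.trans hg'⟩
    obtain ⟨g, e, hg⟩ := key _ H
    exact hg.trans (reflTransGen_rew_of_forall (fun t _ => reflTransGen_rew_of_map_eq t) h' e)
end
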